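/- For any smooth function X^i on E* (the spatial components of a d-vector field), the vertical-vertical Ricci identity holds: X^i|^(j)_(b)|^(k)_(c) − X^i|^(k)_(c)|^(j)_(b) = X^r S^i(j)(k)_r(b)(c) − X^i|^(r)_(f) S^(f)(j)(k)_(r)(b)(c), where S^i(j)(k)_r(b)(c) = ∂C^i(j)_r(b)/∂p_k^c − ∂C^i(k)_r(c)/∂p_j^b + C^s(j)_r(b) C^i(k)_s(c) − C^s(k)_r(c) C^i(j)_s(b) and S^(f)(j)(k)_(r)(b)(c) = −(δ^f_b C^j(k)_r(c) − δ^f_c C^k(j)_r(b)). -/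

import Mathlib

noncomputable section

/-- The dual 1-jet space `E* = ℝ^m × ℝ^n × ℝ^(n×m)`, with coordinates
`(t^a, x^i, p_i^a)`. -/
abbrev Es (m n : ℕ) : Type := (Fin m → ℝ) × (Fin n → ℝ) × (Fin n → Fin m → ℝ)

variable {m n : ℕ}

/-- Kronecker delta. -/
def kd {α : Type*} [DecidableEq α] (a b : α) : ℝ := if a = b then 1 else 0

/-- Partial derivative `∂/∂t^a` on `E*`. -/
def pt (a : Fin m) (F : Es m n → ℝ) (u : Es m n) : ℝ :=
  fderiv ℝ F u (Pi.single a 1, 0, 0)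

/-- Partial derivative `∂/∂x^i` on `E*`. -/
def px (i : Fin n) (F : Es m n → ℝ) (u : Es m n) : ℝ :=
  fderiv ℝ F u (0, Pi.single i 1, 0)

/-- Partial derivative `∂/∂p_i^a` on `E*`. -/
def pp (i : Fin n) (a : Fin m) (F : Es m n → ℝ) (u : Es m n) : ℝ :=
  fderiv ℝ F u (0, 0, Pi.single i (Pi.single a 1))

/-- Adapted derivative `δ/δt^a = ∂/∂t^a - N1^(b)_(j)a ∂/∂p_j^b` of the
nonlinear connection `N = (N1, N2)`; `N1 b j a` stands for `N1^(b)_(j)a`. -/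
def dt (N1 : Fin m → Fin n → Fin m → Es m n → ℝ) (a : Fin m) (F : Es m n → ℝ)
    (u : Es m n) : ℝ :=
  pt a F u - ∑ b, ∑ j, N1 b j a u * pp j b F u

/-- Adapted derivative `δ/δx^i = ∂/∂x^i - N2^(b)_(j)i ∂/∂p_j^b` of the
nonlinear connection `N = (N1, N2)`; `N2 b j i` stands for `N2^(b)_(j)i`. -/
def dx (N2 : Fin m → Fin n → Fin n → Es m n → ℝ) (i : Fin n) (F : Es m n → ℝ)
    (u : Es m n) : ℝ :=
  px i F u - ∑ b, ∑ j, N2 b j i u * pp j b F u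

/-- Partial derivative `∂/∂t^c` on the temporal factor `ℝ^m`. -/
def ptm (c : Fin m) (f : (Fin m → ℝ) → ℝ) (t : Fin m → ℝ) : ℝ :=
  fderiv ℝ f t (Pi.single c 1)

/-- Partial derivative `∂/∂x^k` on the spatial factor `ℝ^n`. -/
def pxn (k : Fin n) (f : (Fin n → ℝ) → ℝ) (x : Fin n → ℝ) : ℝ :=
  fderiv ℝ f x (Pi.single k 1)

/-! ### Christoffel symbols and their curvatures -/

/-- The Christoffel symbols of a (semi-Riemannian) metric `g` with inverse `ginv`
on `ℝ^k`: `γ^a_bc = (1/2) g^{ad} (∂g_db/∂t^c + ∂g_dc/∂t^b - ∂g_bc/∂t^d)`. -/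
def christoffel {k : ℕ} (g ginv : Fin k → Fin k → (Fin k → ℝ) → ℝ)
    (a b c : Fin k) (t : Fin k → ℝ) : ℝ :=
  (1 / 2) * ∑ d, ginv a d t *
    (ptm c (g d b) t + ptm b (g d c) t - ptm d (g b c) t)

/-- The curvature tensor of a family of Christoffel symbols `γ` on `ℝ^k`:
`γ^l_iab = ∂γ^l_ia/∂t^b - ∂γ^l_ib/∂t^a + γ^e_ia γ^l_eb - γ^e_ib γ^l_ea`. -/
def christoffelCurv {k : ℕ} (γ : Fin k → Fin k → Fin k → (Fin k → ℝ) → ℝ)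
    (l i a b : Fin k) (t : Fin k → ℝ) : ℝ :=
  ptm b (γ l i a) t - ptm a (γ l i b) t +
    ∑ e, (γ e i a t * γ l e b t - γ e i b t * γ l e a t)

/-! ### Torsion and curvature d-tensors of an h-normal N-linear connection
`(χ^a_bc, A^i_jc, H^i_jk, C^i(k)_j(c))` on `E*`.  Throughout, `A i j c` stands
for `A^i_jc`, `H i j k` for `H^i_jk` and `C i k j c` for `C^i(k)_j(c)`. -/

section Connection

variable (N1 : Fin m → Fin n → Fin m → Es m n → ℝ)
variable (N2 : Fin m → Fin n → Fin n → Es m n → ℝ)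
variable (χ : Fin m → Fin m → Fin m → (Fin m → ℝ) → ℝ)
variable (A : Fin n → Fin n → Fin m → Es m n → ℝ)
variable (H : Fin n → Fin n → Fin n → Es m n → ℝ)
variable (C : Fin n → Fin n → Fin n → Fin m → Es m n → ℝ)

/-- Torsion `R^(f)_(r)ab = δN1^(f)_(r)a/δt^b - δN1^(f)_(r)b/δt^a`. -/
def RR1 (f : Fin m) (r : Fin n) (a b : Fin m) (u : Es m n) : ℝ :=
  dt N1 b (N1 f r a) u - dt N1 a (N1 f r b) u

/-- Torsion `R^(f)_(r)aj = δN1^(f)_(r)a/δx^j - δN2^(f)_(r)j/δt^a`. -/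
def RRmix (f : Fin m) (r : Fin n) (a : Fin m) (j : Fin n) (u : Es m n) : ℝ :=
  dx N2 j (N1 f r a) u - dt N1 a (N2 f r j) u

/-- Torsion `R^(f)_(r)ij = δN2^(f)_(r)i/δx^j - δN2^(f)_(r)j/δx^i`. -/
def RR2 (f : Fin m) (r i j : Fin n) (u : Es m n) : ℝ :=
  dx N2 j (N2 f r i) u - dx N2 i (N2 f r j) u

/-- Torsion `P^(f)(j)_(r)a(b) = ∂N1^(f)_(r)a/∂p_j^b + δ^f_b A^j_ra - δ^j_r χ^f_ba`. -/
def Ptor1 (f : Fin m) (j : Fin n) (r : Fin n) (a b : Fin m) (u : Es m n) : ℝ :=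
  pp j b (N1 f r a) u + kd f b * A j r a u - kd j r * χ f b a u.1

/-- Torsion `P^(f)(j)_(r)i(b) = ∂N2^(f)_(r)i/∂p_j^b + δ^f_b H^j_ri`. -/
def Ptor2 (f : Fin m) (j r i : Fin n) (b : Fin m) (u : Es m n) : ℝ :=
  pp j b (N2 f r i) u + kd f b * H j r i u

/-- Torsion `S^(f)(j)(k)_(r)(b)(c) = -(δ^f_b C^j(k)_r(c) - δ^f_c C^k(j)_r(b))`. -/
def Stor (f : Fin m) (j k r : Fin n) (b c : Fin m) (u : Es m n) : ℝ :=
  -(kd f b * C j k r c u - kd f c * C k j r b u)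

/-- The `T`-horizontal covariant derivative `C^l(k)_i(c)/b` of `C`. -/
def CcovT (l k i : Fin n) (c : Fin m) (b : Fin m) (u : Es m n) : ℝ :=
  dt N1 b (C l k i c) u + ∑ s, C s k i c u * A l s b u -
    ∑ s, C l k s c u * A s i b u + ∑ s, C l s i c u * A k s b u -
    ∑ f, C l k i f u * χ f c b u.1

/-- The `M`-horizontal covariant derivative
`C^l(k)_i(c)|j = δC^l(k)_i(c)/δx^j + C^s(k)_i(c) H^l_sj - C^l(k)_s(c) H^s_ij
+ C^l(s)_i(c) H^k_sj` of `C`. -/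
def CcovX (l k i : Fin n) (c : Fin m) (j : Fin n) (u : Es m n) : ℝ :=
  dx N2 j (C l k i c) u + ∑ s, C s k i c u * H l s j u -
    ∑ s, C l k s c u * H s i j u + ∑ s, C l s i c u * H k s j u

/-- Curvature `R^l_ibc = δA^l_ib/δt^c - δA^l_ic/δt^b + A^r_ib A^l_rc
- A^r_ic A^l_rb + C^l(r)_i(f) R^(f)_(r)bc`. -/
def curvT (l i : Fin n) (b c : Fin m) (u : Es m n) : ℝ :=
  dt N1 c (A l i b) u - dt N1 b (A l i c) u +
    ∑ r, (A r i b u * A l r c u - A r i c u * A l r b u) +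
    ∑ r, ∑ f, C l r i f u * RR1 N1 f r b c u

/-- Curvature `R^l_ibk = δA^l_ib/δx^k - δH^l_ik/δt^b + A^r_ib H^l_rk
- H^r_ik A^l_rb + C^l(r)_i(f) R^(f)_(r)bk`. -/
def curvMix (l i : Fin n) (b : Fin m) (k : Fin n) (u : Es m n) : ℝ :=
  dx N2 k (A l i b) u - dt N1 b (H l i k) u +
    ∑ r, (A r i b u * H l r k u - H r i k u * A l r b u) +
    ∑ r, ∑ f, C l r i f u * RRmix N1 N2 f r b k u

/-- Curvature `R^l_ijk = δH^l_ij/δx^k - δH^l_ik/δx^j + H^r_ij H^l_rk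
- H^r_ik H^l_rj + C^l(r)_i(f) R^(f)_(r)jk`. -/
def curvH (l i j k : Fin n) (u : Es m n) : ℝ :=
  dx N2 k (H l i j) u - dx N2 j (H l i k) u +
    ∑ r, (H r i j u * H l r k u - H r i k u * H l r j u) +
    ∑ r, ∑ f, C l r i f u * RR2 N2 f r j k u

/-- Curvature `P^l(k)_ib(c) = ∂A^l_ib/∂p_k^c - C^l(k)_i(c)/b
+ C^l(r)_i(f) P^(f)(k)_(r)b(c)`. -/
def curvP1 (l i : Fin n) (b : Fin m) (k : Fin n) (c : Fin m) (u : Es m n) : ℝ :=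
  pp k c (A l i b) u - CcovT N1 χ A C l k i c b u +
    ∑ r, ∑ f, C l r i f u * Ptor1 N1 χ A f k r b c u

/-- Curvature `P^l(k)_ij(c) = ∂H^l_ij/∂p_k^c - C^l(k)_i(c)|j
+ C^l(r)_i(f) P^(f)(k)_(r)j(c)`. -/
def curvP2 (l i j k : Fin n) (c : Fin m) (u : Es m n) : ℝ :=
  pp k c (H l i j) u - CcovX N2 H C l k i c j u +
    ∑ r, ∑ f, C l r i f u * Ptor2 N2 H f k r j c u

/-- Curvature `S^l(j)(k)_i(b)(c) = ∂C^l(j)_i(b)/∂p_k^c - ∂C^l(k)_i(c)/∂p_j^b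
+ C^r(j)_i(b) C^l(k)_r(c) - C^r(k)_i(c) C^l(j)_r(b)`. -/
def curvS (l j k i : Fin n) (b c : Fin m) (u : Es m n) : ℝ :=
  pp k c (C l j i b) u - pp j b (C l k i c) u +
    ∑ r, (C r j i b u * C l k r c u - C r k i c u * C l j r b u)

end Connection

section Ricci12

variable (C : Fin n → Fin n → Fin n → Fin m → Es m n → ℝ)

/-- Vertical covariant derivative `X^i|^(j)_(b) = ∂X^i/∂p_j^b + X^r C^i(j)_r(b)`. -/
def vertXs (X : Fin n → Es m n → ℝ) (i j : Fin n) (b : Fin m) (u : Es m n) : ℝ :=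
  pp j b (X i) u + ∑ r, X r u * C i j r b u

/-- Second vertical covariant derivative
`X^i|^(j)_(b)|^(k)_(c) = ∂(X^i|^(j)_(b))/∂p_k^c + (X^r|^(j)_(b)) C^i(k)_r(c)
+ (X^i|^(r)_(b)) C^j(k)_r(c)`. -/
def vertXs2 (X : Fin n → Es m n → ℝ) (i j : Fin n) (b : Fin m) (k : Fin n)
    (c : Fin m) (u : Es m n) : ℝ :=
  pp k c (fun v => vertXs C X i j b v) u + ∑ r, vertXs C X r j b u * C i k r c u +
    ∑ r, vertXs C X i r b u * C j k r c u

end Ricci12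

/-- Smooth functions are in particular twice differentiable. -/
theorem two_le_smooth : (2 : WithTop ℕ∞) ≤ ((⊤ : ℕ∞) : WithTop ℕ∞) :=
  WithTop.coe_le_coe.2 (le_top : (2 : ℕ∞) ≤ ⊤)

/-- Partial derivatives in the fibre directions commute. -/
theorem pp_comm {m n : ℕ} (F : Es m n → ℝ) (hF : ContDiff ℝ (⊤ : ℕ∞) F)
    (j k : Fin n) (b c : Fin m) (u : Es m n) :
    pp k c (fun v => pp j b F v) u = pp j b (fun v => pp k c F v) u := by
  have hd : DifferentiableAt ℝ (fderiv ℝ F) u :=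
    ((hF.fderiv_right (m := 1) (by rw [one_add_one_eq_two]; exact two_le_smooth)).differentiable one_ne_zero) u
  have hs : IsSymmSndFDerivAt ℝ F u :=
    hF.contDiffAt.isSymmSndFDerivAt (by simpa using two_le_smooth)
  unfold pp
  rw [fderiv_clm_apply hd (differentiableAt_const _),
    fderiv_clm_apply hd (differentiableAt_const _)]
  simp
  exact hs _ _

/-- The fibre derivative of the first vertical covariant derivative. -/
theorem pp_vertXs {m n : ℕ} (C : Fin n → Fin n → Fin n → Fin m → Es m n → ℝ)
    (hCs : ∀ i k j c, ContDiff ℝ (⊤ : ℕ∞) (C i k j c))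
    (X : Fin n → Es m n → ℝ) (hX : ∀ i, ContDiff ℝ (⊤ : ℕ∞) (X i))
    (i j k : Fin n) (b c : Fin m) (u : Es m n) :
    pp k c (fun v => vertXs C X i j b v) u =
      pp k c (fun v => pp j b (X i) v) u +
        ∑ r, (X r u * pp k c (C i j r b) u + pp k c (X r) u * C i j r b u) := by
  have hXd : ∀ r, DifferentiableAt ℝ (X r) u := fun r => (hX r).differentiable (by simp) u
  have hCd : ∀ r, DifferentiableAt ℝ (C i j r b) u :=
    fun r => (hCs i j r b).differentiable (by simp) u
  have hd : DifferentiableAt ℝ (fderiv ℝ (X i)) u :=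
    (((hX i).fderiv_right (m := 1) (by rw [one_add_one_eq_two]; exact two_le_smooth)).differentiable one_ne_zero) u
  unfold vertXs pp
  rw [fderiv_fun_add (hd.clm_apply (differentiableAt_const _))
    (DifferentiableAt.fun_sum fun r _ => (hXd r).fun_mul (hCd r)),
    fderiv_fun_sum fun r _ => (hXd r).fun_mul (hCd r)]
  simp only [ContinuousLinearMap.add_apply, ContinuousLinearMap.sum_apply]
  congr 1
  refine Finset.sum_congr rfl fun r _ => ?_
  rw [fderiv_fun_mul (hXd r) (hCd r)]
  simp [mul_comm]

/-- For any smooth `X^i` on `E*`, the vertical-vertical Ricci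
identity of an `h`-normal `N`-linear connection of Cartan type holds:
`X^i|^(j)_(b)|^(k)_(c) - X^i|^(k)_(c)|^(j)_(b)
  = X^r S^i(j)(k)_r(b)(c) - X^i|^(r)_(f) S^(f)(j)(k)_(r)(b)(c)`. -/
theorem vertical_Ricci_identity (m n : ℕ) (hm : 1 ≤ m) (hn : 1 ≤ n)
    -- the temporal metric `h`, its inverse, and its Christoffel symbols `χ`
    (h hinv : Fin m → Fin m → (Fin m → ℝ) → ℝ)
    (hsmooth : ∀ a b, ContDiff ℝ (⊤ : ℕ∞) (h a b)) (hinvsmooth : ∀ a b, ContDiff ℝ (⊤ : ℕ∞) (hinv a b))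
    (hsym : ∀ t a b, h a b t = h b a t)
    (hinverse : ∀ t a b, ∑ f, hinv a f t * h f b t = kd a b)
    (χ : Fin m → Fin m → Fin m → (Fin m → ℝ) → ℝ)
    (hχ : ∀ a b c t, χ a b c t = christoffel h hinv a b c t)
    -- the nonlinear connection `N = (N1, N2)`
    (N1 : Fin m → Fin n → Fin m → Es m n → ℝ)
    (N2 : Fin m → Fin n → Fin n → Es m n → ℝ)
    (hN1 : ∀ e r a, ContDiff ℝ (⊤ : ℕ∞) (N1 e r a)) (hN2 : ∀ e r i, ContDiff ℝ (⊤ : ℕ∞) (N2 e r i))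
    -- the remaining components `A^i_jc`, `H^i_jk`, `C^i(k)_j(c)` of the
    -- `h`-normal `N`-linear connection of Cartan type `CDΓ(N)`
    (A : Fin n → Fin n → Fin m → Es m n → ℝ)
    (H : Fin n → Fin n → Fin n → Es m n → ℝ)
    (C : Fin n → Fin n → Fin n → Fin m → Es m n → ℝ)
    (hAs : ∀ i j c, ContDiff ℝ (⊤ : ℕ∞) (A i j c)) (hHs : ∀ i j k, ContDiff ℝ (⊤ : ℕ∞) (H i j k))
    (hCs : ∀ i k j c, ContDiff ℝ (⊤ : ℕ∞) (C i k j c))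
    (hHsym : ∀ i j k (u : Es m n), H i j k u = H i k j u)
    (hCsym : ∀ i k j c (u : Es m n), C i k j c u = C k i j c u)
    -- the spatial components of a d-vector field
    (X : Fin n → Es m n → ℝ) (hX : ∀ i, ContDiff ℝ (⊤ : ℕ∞) (X i)) :
    ∀ (u : Es m n) (i j k : Fin n) (b c : Fin m),
      vertXs2 C X i j b k c u - vertXs2 C X i k c j b u =
        (∑ r, X r u * curvS C i j k r b c u) -
          ∑ f, ∑ r, vertXs C X i r f u * Stor C f j k r b c u := by
  intro u i j k b c
  have hT : ∑ f, ∑ r, vertXs C X i r f u * Stor C f j k r b c u =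
      -(∑ r, vertXs C X i r b u * C j k r c u) + ∑ r, vertXs C X i r c u * C k j r b u := by
    rw [Finset.sum_comm, ← Finset.sum_neg_distrib, ← Finset.sum_add_distrib]
    refine Finset.sum_congr rfl fun r _ => ?_
    simp [Stor, kd, mul_add, mul_sub, Finset.sum_add_distrib, Finset.sum_sub_distrib]
    ring
  have hV : ∀ (j k : Fin n) (b c : Fin m), ∑ r, vertXs C X r j b u * C i k r c u =
      (∑ r, pp j b (X r) u * C i k r c u) +
        ∑ r, X r u * ∑ s, C s j r b u * C i k s c u := by
    intro j k b c
    simp only [vertXs, add_mul, Finset.sum_add_distrib, Finset.sum_mul, Finset.mul_sum]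
    rw [Finset.sum_comm (f := fun r s => X s u * C r j s b u * C i k r c u)]
    simp only [mul_assoc]
  rw [hT]
  unfold vertXs2
  rw [hV, hV, pp_vertXs C hCs X hX, pp_vertXs C hCs X hX, pp_comm (X i) (hX i) j k b c u]
  simp only [curvS, mul_add, mul_sub, Finset.sum_add_distrib, Finset.sum_sub_distrib]
  ring
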